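/- Let n and k be integers with k ≥ 1 and 2k < n + 2. Set C(k,n) = Γ(n/2+1−k)/(2^{2k−1}·(k−1)!·Γ(n/2+1)) and, for 0 < r ≤ s, φ_k(r,s) = C(k,n)·s^{2k−2−n}·∑_{j=0}^{k−1} (−1)^j·binom(k−1,j)·((n/2+1−k)_j/(n/2+1)_j)·(r/s)^{2j}. Then for all 0 < s ≤ r: (n+2−2k)·φ_k(s,r) + r·(d/dt φ_k(s,t))|_{t=r} ≥ 0, where the derivative is taken in the second argument. -/

import Mathlib

/-- The rising factorial (Pochhammer symbol) `(x)_j = x(x+1)⋯(x+j-1)`. -/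
noncomputable def risingFactorial (j : ℕ) (x : ℝ) : ℝ := (ascPochhammer ℝ j).eval x

/-- The constant `C(k,n) = Γ(n/2+1-k)/(2^{2k-1} (k-1)! Γ(n/2+1))`. -/
noncomputable def Ckn (k n : ℕ) : ℝ :=
  Real.Gamma ((n : ℝ) / 2 + 1 - k)
    / (2 ^ (2 * k - 1) * (Nat.factorial (k - 1) : ℝ) * Real.Gamma ((n : ℝ) / 2 + 1))

/-- The kernel factor
`φ_k(r,s) = C(k,n) s^{2k-2-n} ∑_{j=0}^{k-1} (-1)^j binom(k-1,j) ((n/2+1-k)_j/(n/2+1)_j) (r/s)^{2j}`,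
the finite sum being the terminating hypergeometric series `F(1-k, n/2+1-k; n/2+1; r²/s²)`. -/
noncomputable def phiK (k n : ℕ) (r s : ℝ) : ℝ :=
  Ckn k n * s ^ (2 * (k : ℤ) - 2 - (n : ℤ))
    * ∑ j ∈ Finset.range k,
        (-1 : ℝ) ^ j * (Nat.choose (k - 1) j : ℝ)
          * (risingFactorial j ((n : ℝ) / 2 + 1 - k) / risingFactorial j ((n : ℝ) / 2 + 1))
          * (r / s) ^ (2 * j)

theorem risingFactorial_zero (x : ℝ) : risingFactorial 0 x = 1 := by
  simp [risingFactorial]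

theorem risingFactorial_pos (j : ℕ) {x : ℝ} (hx : 0 < x) : 0 < risingFactorial j x :=
  ascPochhammer_pos j x hx

theorem risingFactorial_succ_left (j : ℕ) (x : ℝ) :
    risingFactorial (j + 1) x = x * risingFactorial j (x + 1) := by
  simp [risingFactorial, ascPochhammer_succ_left]

theorem risingFactorial_succ_right (j : ℕ) (x : ℝ) :
    risingFactorial (j + 1) x = risingFactorial j x * (x + j) :=
  ascPochhammer_succ_eval j x

/-- The quotient `(b)_j / (c)_j`. -/
noncomputable def pochhammerRatio (b c : ℝ) (j : ℕ) : ℝ :=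
  risingFactorial j b / risingFactorial j c

theorem pochhammerRatio_succ (b c : ℝ) (j : ℕ) :
    pochhammerRatio b c (j + 1) = b / c * pochhammerRatio (b + 1) (c + 1) j := by
  simp only [pochhammerRatio, risingFactorial_succ_left]
  rw [mul_div_mul_comm]

theorem pochhammerRatio_contiguous {b c : ℝ} (hc : 0 < c) (j : ℕ) :
    pochhammerRatio b c j =
      (c - b) / c * pochhammerRatio b (c + 1) j
        + b / c * pochhammerRatio (b + 1) (c + 1) j := by
  have hb' := (risingFactorial_succ_left j b).symm.trans (risingFactorial_succ_right j b)
  have hc' := (risingFactorial_succ_left j c).symm.trans (risingFactorial_succ_right j c)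
  have h1 := (risingFactorial_pos j hc).ne'
  have h2 := (risingFactorial_pos j (by linarith : 0 < c + 1)).ne'
  simp only [pochhammerRatio]
  field_simp
  linear_combination risingFactorial j b * hc' - risingFactorial j c * hb'

/-- The sum `∑_{j ≤ p} (-1)^j binom(p,j) a_j x^j`. -/
noncomputable def alternatingBinomialSum (p : ℕ) (a : ℕ → ℝ) (x : ℝ) : ℝ :=
  ∑ j ∈ Finset.range (p + 1), (-1 : ℝ) ^ j * (Nat.choose p j : ℝ) * a j * x ^ j

theorem alternatingBinomialSum_succ (p : ℕ) (a : ℕ → ℝ) (x : ℝ) :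
    alternatingBinomialSum (p + 1) a x =
      alternatingBinomialSum p a x - x * alternatingBinomialSum p (fun j => a (j + 1)) x := by
  have h : alternatingBinomialSum p a x =
      ∑ j ∈ Finset.range (p + 1 + 1), (-1 : ℝ) ^ j * (Nat.choose p j : ℝ) * a j * x ^ j := by
    rw [Finset.sum_range_succ]
    simp [alternatingBinomialSum]
  rw [h, Finset.sum_range_succ', alternatingBinomialSum, Finset.sum_range_succ',
    alternatingBinomialSum, Finset.mul_sum, add_sub_right_comm, ← Finset.sum_sub_distrib]
  congr 1
  · refine Finset.sum_congr rfl fun j _ => ?_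
    rw [Nat.choose_succ_succ]
    push_cast
    ring
  · simp

theorem alternatingBinomialSum_linear (p : ℕ) (a a' : ℕ → ℝ) (u v x : ℝ) :
    alternatingBinomialSum p (fun j => u * a j + v * a' j) x =
      u * alternatingBinomialSum p a x + v * alternatingBinomialSum p a' x := by
  simp only [alternatingBinomialSum, Finset.mul_sum, ← Finset.sum_add_distrib]
  exact Finset.sum_congr rfl fun j _ => by ring

theorem alternatingBinomialSum_const_mul (p : ℕ) (a : ℕ → ℝ) (u x : ℝ) :
    alternatingBinomialSum p (fun j => u * a j) x = u * alternatingBinomialSum p a x := by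
  simpa using alternatingBinomialSum_linear p a a u 0 x

/-- The terminating series `F(-p, b; c; x)` is nonnegative on `[0, 1]` when `0 < b ≤ c`. -/
theorem alternatingBinomialSum_pochhammerRatio_nonneg (p : ℕ) {b c x : ℝ}
    (hb : 0 < b) (hbc : b ≤ c) (hx : x ≤ 1) :
    0 ≤ alternatingBinomialSum p (pochhammerRatio b c) x := by
  induction p generalizing b c with
  | zero => simp [alternatingBinomialSum, pochhammerRatio, risingFactorial_zero]
  | succ p ih =>
    have hc : 0 < c := hb.trans_le hbc
    have key : alternatingBinomialSum (p + 1) (pochhammerRatio b c) x =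
        (c - b) / c * alternatingBinomialSum p (pochhammerRatio b (c + 1)) x
          + (1 - x) * (b / c * alternatingBinomialSum p (pochhammerRatio (b + 1) (c + 1)) x) := by
      rw [alternatingBinomialSum_succ, funext (pochhammerRatio_contiguous hc),
        alternatingBinomialSum_linear, ← funext (pochhammerRatio_contiguous hc),
        funext (pochhammerRatio_succ b c), alternatingBinomialSum_const_mul]
      ring
    rw [key]
    have h1 := ih hb (by linarith : b ≤ c + 1)
    have h2 := ih (by linarith : 0 < b + 1) (by linarith : b + 1 ≤ c + 1)
    have h3 : 0 ≤ c - b := sub_nonneg.2 hbc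
    have h4 : 0 ≤ 1 - x := sub_nonneg.2 hx
    positivity

/-- Applying the Euler operator `x d/dx` to an alternating binomial sum of degree `p + 1`. -/
theorem sum_index_mul_alternatingBinomial (p : ℕ) (a : ℕ → ℝ) (x : ℝ) :
    ∑ j ∈ Finset.range (p + 2),
        (j : ℝ) * ((-1 : ℝ) ^ j * (Nat.choose (p + 1) j : ℝ) * a j * x ^ j) =
      -((p + 1) * x * alternatingBinomialSum p (fun j => a (j + 1)) x) := by
  rw [Finset.sum_range_succ', alternatingBinomialSum, Finset.mul_sum, ← Finset.sum_neg_distrib]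
  simp only [Nat.cast_zero, zero_mul, add_zero]
  refine Finset.sum_congr rfl fun j _ => ?_
  have h : ((p : ℝ) + 1) * (p.choose j : ℝ) = ((p + 1).choose (j + 1) : ℝ) * (j + 1) := by
    exact_mod_cast Nat.add_one_mul_choose_eq p j
  push_cast
  linear_combination -(-1) ^ j * a (j + 1) * x ^ (j + 1) * (-h)

theorem sum_index_mul_pochhammerRatio_nonpos (m : ℕ) {b c x : ℝ}
    (hb : 0 < b) (hbc : b ≤ c) (hx₀ : 0 ≤ x) (hx : x ≤ 1) :
    ∑ j ∈ Finset.range (m + 1),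
      (j : ℝ) * ((-1 : ℝ) ^ j * (Nat.choose m j : ℝ) * pochhammerRatio b c j * x ^ j) ≤ 0 := by
  cases m with
  | zero => simp
  | succ p =>
    have hc : 0 < c := hb.trans_le hbc
    have h := alternatingBinomialSum_pochhammerRatio_nonneg p (by linarith : 0 < b + 1)
      (by linarith : b + 1 ≤ c + 1) hx
    rw [sum_index_mul_alternatingBinomial, funext (pochhammerRatio_succ b c),
      alternatingBinomialSum_const_mul, neg_nonpos]
    positivity

theorem Ckn_nonneg {k n : ℕ} (h : 2 * k < n + 2) : 0 ≤ Ckn k n := by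
  have h' : (2 : ℝ) * k < n + 2 := by exact_mod_cast h
  have h1 := Real.Gamma_pos_of_pos (by linarith : 0 < (n : ℝ) / 2 + 1 - k)
  have h2 := Real.Gamma_pos_of_pos (by positivity : 0 < (n : ℝ) / 2 + 1)
  unfold Ckn
  positivity

theorem hasDerivAt_div_pow (s : ℝ) {r : ℝ} (hr : r ≠ 0) (j : ℕ) :
    HasDerivAt (fun t : ℝ => (s / t) ^ (2 * j)) (-(2 * j * (s / r) ^ (2 * j) / r)) r := by
  have h := ((hasDerivAt_inv hr).const_mul s).fun_pow (2 * j)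
  simp only [← div_eq_mul_inv] at h
  refine h.congr_deriv ?_
  rcases j with _ | j
  · simp
  · have e : 2 * (j + 1) - 1 = 2 * j + 1 := by omega
    have e' : 2 * (j + 1) = 2 * j + 1 + 1 := by omega
    rw [e, e', pow_succ (s / r) (2 * j + 1)]
    push_cast
    field_simp
    ring

/-- The Euler operator `t d/dt` on `t ^ e * ∑ A_j (s / t)^{2j}`. -/
theorem mul_deriv_zpow_mul_sum (C s : ℝ) {r : ℝ} (hr : r ≠ 0) (e : ℤ) (N : ℕ) (A : ℕ → ℝ) :
    r * deriv (fun t : ℝ => C * t ^ e * ∑ j ∈ Finset.range N, A j * (s / t) ^ (2 * j)) r =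
      e * (C * r ^ e * ∑ j ∈ Finset.range N, A j * (s / r) ^ (2 * j))
        - 2 * (C * r ^ e * ∑ j ∈ Finset.range N, j * (A j * (s / r) ^ (2 * j))) := by
  have h := ((hasDerivAt_zpow e r (Or.inl hr)).const_mul C).fun_mul
    (HasDerivAt.fun_sum (u := Finset.range N)
      fun j _ => (hasDerivAt_div_pow s hr j).const_mul (A j))
  have hs : ∑ j ∈ Finset.range N, A j * -(2 * j * (s / r) ^ (2 * j) / r) =
      -(2 / r) * ∑ j ∈ Finset.range N, j * (A j * (s / r) ^ (2 * j)) := by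
    rw [Finset.mul_sum]
    exact Finset.sum_congr rfl fun j _ => by ring
  rw [h.deriv, hs, zpow_sub_one₀ hr]
  field_simp
  ring

/-- First kernel condition for the comparison-based breakdown criterion:
for `1 ≤ k`, `2k < n + 2`, and `0 < s ≤ r`,
`(n+2-2k) φ_k(s,r) + r ∂₂φ_k(s,r) ≥ 0`, the derivative being in the second argument. -/
theorem kernel_condition_one
    (n k : ℕ) (hk : 1 ≤ k) (hkn : 2 * k < n + 2) :
    ∀ r s : ℝ, 0 < s → s ≤ r →
      0 ≤ ((n : ℝ) + 2 - 2 * k) * phiK k n s r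
          + r * deriv (fun t => phiK k n s t) r := by
  intro r s hs hsr
  have hr : 0 < r := hs.trans_le hsr
  have hkn' : (2 : ℝ) * k < n + 2 := by exact_mod_cast hkn
  have hC := Ckn_nonneg hkn
  have hsum := sum_index_mul_pochhammerRatio_nonpos (k - 1)
    (by linarith : 0 < (n : ℝ) / 2 + 1 - k) (by simp : (n : ℝ) / 2 + 1 - k ≤ (n : ℝ) / 2 + 1)
    (sq_nonneg (s / r)) (pow_le_one₀ (by positivity) ((div_le_one hr).2 hsr))
  simp only [Nat.sub_add_cancel hk, ← pow_mul, pochhammerRatio] at hsum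
  have hprod := mul_nonneg (mul_nonneg hC (zpow_pos hr (2 * (k : ℤ) - 2 - n)).le)
    (neg_nonneg.2 hsum)
  unfold phiK
  rw [mul_deriv_zpow_mul_sum _ _ hr.ne']
  push_cast
  linear_combination 2 * hprod
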